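/- Let Y₁ = {Y₁(t), t ≥ 0} and Y₂ = {Y₂(t), t ≥ 0} be real-valued stochastic processes on a common probability space and let q ≥ 1. Suppose that for every t > 0 the random variables Y₁(t) and Y₂(t) are independent, integrable with E Y₁(t) = E Y₂(t) = 0, and satisfy 0 < E|Y₁(t)|^q < ∞ and 0 < E|Y₂(t)|^q < ∞; suppose the scaling functions τ_{Y₁}(q) and τ_{Y₂}(q) exist, are finite and positive. Then liminf_{t→∞} (log E|Y₁(t) + Y₂(t)|^q)/(log t) ≥ max{τ_{Y₁}(q), τ_{Y₂}(q)}. -/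

import Mathlib

open MeasureTheory Filter

/-- The crude bound `|x + y| ^ q ≤ 2 ^ (q - 1) * (|x| ^ q + |y| ^ q)` for `q ≥ 1`. -/
theorem abs_add_rpow_le_mul_rpow_add_rpow {q : ℝ} (hq : 1 ≤ q) (x y : ℝ) :
    |x + y| ^ q ≤ 2 ^ (q - 1) * (|x| ^ q + |y| ^ q) :=
  (Real.rpow_le_rpow (abs_nonneg _) (abs_add_le x y) (by linarith)).trans
    (by exact_mod_cast NNReal.rpow_add_le_mul_rpow_add_rpow (Real.nnabs x) (Real.nnabs y) hq)

theorem convexOn_abs_rpow {q : ℝ} (hq : 1 ≤ q) :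
    ConvexOn ℝ Set.univ (fun x : ℝ => |x| ^ q) := by
  refine ⟨convex_univ, fun x _ y _ a b ha hb hab => ?_⟩
  have h := (convexOn_rpow hq).2 (Set.mem_Ici.2 (abs_nonneg x)) (Set.mem_Ici.2 (abs_nonneg y))
    ha hb hab
  refine le_trans (Real.rpow_le_rpow (abs_nonneg _) ?_ (by linarith)) h
  simpa [abs_mul, abs_of_nonneg ha, abs_of_nonneg hb] using abs_add_le (a * x) (b * y)

theorem integrable_abs_add_rpow {Ω : Type*} [MeasurableSpace Ω] {P : Measure Ω}
    {X Y : Ω → ℝ} {q : ℝ} (hq : 1 ≤ q) (hX : Measurable X) (hY : Measurable Y)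
    (hXq : Integrable (fun ω => |X ω| ^ q) P) (hYq : Integrable (fun ω => |Y ω| ^ q) P) :
    Integrable (fun ω => |X ω + Y ω| ^ q) P := by
  refine ((hXq.add hYq).const_mul (2 ^ (q - 1))).mono'
    (((hX.add hY).abs.pow_const q).aestronglyMeasurable) (ae_of_all _ fun ω => ?_)
  rw [Real.norm_of_nonneg (by positivity)]
  exact abs_add_rpow_le_mul_rpow_add_rpow hq _ _

/-- Adding an independent centered random variable does not decrease the `q`-th absolute moment. -/
theorem integral_abs_rpow_le_integral_abs_add_rpow {Ω : Type*} [MeasurableSpace Ω]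
    {P : Measure Ω} [IsProbabilityMeasure P] {X Y : Ω → ℝ} {q : ℝ} (hq : 1 ≤ q)
    (hX : Measurable X) (hY : Measurable Y) (hXY : ProbabilityTheory.IndepFun X Y P)
    (hYint : Integrable Y P) (hYmean : ∫ ω, Y ω ∂P = 0)
    (hXq : Integrable (fun ω => |X ω| ^ q) P) (hYq : Integrable (fun ω => |Y ω| ^ q) P) :
    ∫ ω, |X ω| ^ q ∂P ≤ ∫ ω, |X ω + Y ω| ^ q ∂P := by
  have := Measure.isProbabilityMeasure_map (μ := P) hX.aemeasurable
  have := Measure.isProbabilityMeasure_map (μ := P) hY.aemeasurable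
  have hpair : P.map (fun ω => (X ω, Y ω)) = (P.map X).prod (P.map Y) :=
    (ProbabilityTheory.indepFun_iff_map_prod_eq_prod_map_map hX.aemeasurable hY.aemeasurable).1 hXY
  have hg : Measurable fun x : ℝ => |x| ^ q := measurable_id.abs.pow_const q
  have hG : Measurable fun z : ℝ × ℝ => |z.1 + z.2| ^ q :=
    (measurable_fst.add measurable_snd).abs.pow_const q
  have hGint : Integrable (fun z : ℝ × ℝ => |z.1 + z.2| ^ q) ((P.map X).prod (P.map Y)) := by
    rw [← hpair, integrable_map_measure hG.aestronglyMeasurable (hX.prodMk hY).aemeasurable]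
    exact integrable_abs_add_rpow hq hX hY hXq hYq
  have hsum : ∫ ω, |X ω + Y ω| ^ q ∂P = ∫ x, ∫ y, |x + y| ^ q ∂(P.map Y) ∂(P.map X) := by
    rw [← integral_prod _ hGint, ← hpair,
      integral_map (hX.prodMk hY).aemeasurable hG.aestronglyMeasurable]
  have hXmap : ∫ ω, |X ω| ^ q ∂P = ∫ x, |x| ^ q ∂(P.map X) :=
    (integral_map hX.aemeasurable hg.aestronglyMeasurable).symm
  rw [hsum, hXmap]
  refine integral_mono ?_ hGint.integral_prod_left fun x => ?_
  · exact (integrable_map_measure hg.aestronglyMeasurable hX.aemeasurable).2 hXq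
  · have hshift : Measurable fun y : ℝ => |x + y| ^ q :=
      (measurable_const.add measurable_id).abs.pow_const q
    have hjensen := (convexOn_abs_rpow hq).map_integral_le (μ := P) (f := fun ω => x + Y ω)
      (continuousOn_id.abs.rpow_const fun _ _ => Or.inr (by linarith)) isClosed_univ
      (ae_of_all _ fun _ => Set.mem_univ _) ((integrable_const x).add hYint)
      (integrable_abs_add_rpow hq measurable_const hY (integrable_const _) hYq)
    rw [integral_add (integrable_const x) hYint, hYmean] at hjensen
    simp only [integral_const, probReal_univ, one_smul, add_zero] at hjensen
    simpa only [integral_map hY.aemeasurable hshift.aestronglyMeasurable] using hjensen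

/-- A positive function dominated by a multiple of the sum of two functions with finite logarithmic
growth rates has logarithmic growth rate bounded above. -/
theorem isBoundedUnder_le_log_div_log_of_le_mul_add {A B S : ℝ → ℝ} {C a b : ℝ} (hC : 0 < C)
    (hA : ∀ t, 0 < t → 0 < A t) (hB : ∀ t, 0 < t → 0 < B t) (hS : ∀ t, 0 < t → 0 < S t)
    (hle : ∀ t, 0 < t → S t ≤ C * (A t + B t))
    (ha : Tendsto (fun t => Real.log (A t) / Real.log t) atTop (nhds a))
    (hb : Tendsto (fun t => Real.log (B t) / Real.log t) atTop (nhds b)) :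
    IsBoundedUnder (· ≤ ·) atTop (fun t => Real.log (S t) / Real.log t) := by
  set M := max a b + 1
  have hpow : ∀ {F : ℝ → ℝ} {t : ℝ}, 0 < t → 0 < F t → 0 < Real.log t →
      Real.log (F t) / Real.log t < M → F t ≤ t ^ M := by
    intro F t ht hF hlog h
    rw [← Real.log_le_log_iff hF (Real.rpow_pos_of_pos ht M), Real.log_rpow ht]
    exact ((div_lt_iff₀ hlog).1 h).le
  refine ⟨|Real.log (2 * C)| + M, eventually_map.2 ?_⟩
  filter_upwards [ha.eventually_lt_const (show a < M from (le_max_left a b).trans_lt (lt_add_one _)),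
    hb.eventually_lt_const (show b < M from (le_max_right a b).trans_lt (lt_add_one _)),
    eventually_gt_atTop 0, Real.tendsto_log_atTop.eventually_ge_atTop 1] with t hat hbt ht hlog
  have hlog0 : 0 < Real.log t := by linarith
  have htM := Real.rpow_pos_of_pos ht M
  have hbound : S t ≤ 2 * C * t ^ M := by
    have := mul_le_mul_of_nonneg_left
      (add_le_add (hpow ht (hA t ht) hlog0 hat) (hpow ht (hB t ht) hlog0 hbt)) hC.le
    linarith [hle t ht]
  have hlogS := Real.log_le_log (hS t ht) hbound
  rw [Real.log_mul (by positivity) htM.ne', Real.log_rpow ht] at hlogS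
  rw [div_le_iff₀ hlog0, add_mul]
  have h₁ := le_abs_self (Real.log (2 * C))
  have h₂ := le_mul_of_one_le_right (abs_nonneg (Real.log (2 * C))) hlog
  linarith

/-- If `F ≤ S` then the logarithmic growth rate of `F` bounds that of `S` from below. -/
theorem le_liminf_log_div_log {F S : ℝ → ℝ} {a : ℝ}
    (hF : ∀ t, 0 < t → 0 < F t) (hle : ∀ t, 0 < t → F t ≤ S t)
    (ha : Tendsto (fun t => Real.log (F t) / Real.log t) atTop (nhds a))
    (hS : IsBoundedUnder (· ≤ ·) atTop (fun t => Real.log (S t) / Real.log t)) :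
    a ≤ liminf (fun t => Real.log (S t) / Real.log t) atTop := by
  rw [← ha.liminf_eq]
  refine liminf_le_liminf ?_ ha.isBoundedUnder_ge hS.isCoboundedUnder_ge
  filter_upwards [eventually_gt_atTop 1] with t ht
  have ht0 : 0 < t := by linarith
  exact div_le_div_of_nonneg_right (Real.log_le_log (hF t ht0) (hle t ht0)) (Real.log_pos ht).le

/-- `q ≥ 1`, independent centered components with existing positive
scaling functions: `liminf_{t→∞} log E|Y₁(t)+Y₂(t)|^q / log t ≥ max{τ₁, τ₂}`. -/
theorem scaling_function_sum_liminf_ge_of_one_le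
    {Ω : Type*} [MeasurableSpace Ω] (P : Measure Ω) [IsProbabilityMeasure P]
    (Y₁ Y₂ : ℝ → Ω → ℝ) (q : ℝ) (hq : 1 ≤ q)
    (hm₁ : ∀ t : ℝ, 0 < t → Measurable (Y₁ t))
    (hm₂ : ∀ t : ℝ, 0 < t → Measurable (Y₂ t))
    (hindep : ∀ t : ℝ, 0 < t → ProbabilityTheory.IndepFun (Y₁ t) (Y₂ t) P)
    (hint₁ : ∀ t : ℝ, 0 < t → Integrable (Y₁ t) P)
    (hint₂ : ∀ t : ℝ, 0 < t → Integrable (Y₂ t) P)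
    (hmean₁ : ∀ t : ℝ, 0 < t → ∫ ω, Y₁ t ω ∂P = 0)
    (hmean₂ : ∀ t : ℝ, 0 < t → ∫ ω, Y₂ t ω ∂P = 0)
    (hi₁ : ∀ t : ℝ, 0 < t → Integrable (fun ω => |Y₁ t ω| ^ q) P)
    (hi₂ : ∀ t : ℝ, 0 < t → Integrable (fun ω => |Y₂ t ω| ^ q) P)
    (hp₁ : ∀ t : ℝ, 0 < t → 0 < ∫ ω, |Y₁ t ω| ^ q ∂P)
    (hp₂ : ∀ t : ℝ, 0 < t → 0 < ∫ ω, |Y₂ t ω| ^ q ∂P)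
    (τ₁ τ₂ : ℝ) (hτ₁pos : 0 < τ₁) (hτ₂pos : 0 < τ₂)
    (hτ₁ : Tendsto (fun t : ℝ => Real.log (∫ ω, |Y₁ t ω| ^ q ∂P) / Real.log t)
      atTop (nhds τ₁))
    (hτ₂ : Tendsto (fun t : ℝ => Real.log (∫ ω, |Y₂ t ω| ^ q ∂P) / Real.log t)
      atTop (nhds τ₂)) :
    max τ₁ τ₂ ≤
      liminf (fun t : ℝ => Real.log (∫ ω, |Y₁ t ω + Y₂ t ω| ^ q ∂P) / Real.log t)
        atTop := by
  have hle₁ : ∀ t : ℝ, 0 < t → ∫ ω, |Y₁ t ω| ^ q ∂P ≤ ∫ ω, |Y₁ t ω + Y₂ t ω| ^ q ∂P :=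
    fun t ht => integral_abs_rpow_le_integral_abs_add_rpow hq (hm₁ t ht) (hm₂ t ht) (hindep t ht)
      (hint₂ t ht) (hmean₂ t ht) (hi₁ t ht) (hi₂ t ht)
  have hle₂ : ∀ t : ℝ, 0 < t → ∫ ω, |Y₂ t ω| ^ q ∂P ≤ ∫ ω, |Y₁ t ω + Y₂ t ω| ^ q ∂P := by
    intro t ht
    simpa only [add_comm] using integral_abs_rpow_le_integral_abs_add_rpow hq (hm₂ t ht) (hm₁ t ht)
      (hindep t ht).symm (hint₁ t ht) (hmean₁ t ht) (hi₂ t ht) (hi₁ t ht)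
  have hub : ∀ t : ℝ, 0 < t → ∫ ω, |Y₁ t ω + Y₂ t ω| ^ q ∂P ≤
      2 ^ (q - 1) * (∫ ω, |Y₁ t ω| ^ q ∂P + ∫ ω, |Y₂ t ω| ^ q ∂P) := by
    intro t ht
    rw [← integral_add (hi₁ t ht) (hi₂ t ht), ← integral_const_mul]
    exact integral_mono (integrable_abs_add_rpow hq (hm₁ t ht) (hm₂ t ht) (hi₁ t ht) (hi₂ t ht))
      (((hi₁ t ht).add (hi₂ t ht)).const_mul _)
      fun ω => abs_add_rpow_le_mul_rpow_add_rpow hq _ _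
  have hbdd := isBoundedUnder_le_log_div_log_of_le_mul_add
    (Real.rpow_pos_of_pos two_pos (q - 1)) hp₁ hp₂
    (fun t ht => (hp₁ t ht).trans_le (hle₁ t ht)) hub hτ₁ hτ₂
  exact max_le (le_liminf_log_div_log hp₁ hle₁ hτ₁ hbdd) (le_liminf_log_div_log hp₂ hle₂ hτ₂ hbdd)
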